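/- arXiv:2508.01645 — 2 statements merged into one kernel-verified Lean document; each statement's English description precedes it below -/
import Mathlib

section
/- In any MT-algebra, joins of open elements are exact with respect to saturated elements: for every saturated element a and every set S of open elements, ⨅{u open : a ⊓ s ≤ u for all s ∈ S} = a ⊓ ⨆S. (In particular, the join of {a ⊓ s : s ∈ S} computed in the lattice of saturated elements equals a ⊓ ⨆S.) -/
/-- An element `u` is open w.r.t. the interior operator `box` if `box u = u`. -/
def MTOpen {M : Type*} [CompleteBooleanAlgebra M] (box : M → M) (u : M) : Prop :=
  box u = u

/-- The closure operator `◇a = ¬□¬a`. -/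
def MTdia {M : Type*} [CompleteBooleanAlgebra M] (box : M → M) (a : M) : M :=
  (box aᶜ)ᶜ

/-- An element `c` is closed if `◇c = c`. -/
def MTClosed {M : Type*} [CompleteBooleanAlgebra M] (box : M → M) (c : M) : Prop :=
  MTdia box c = c

/-- `box` is an interior operator making the complete Boolean algebra `M` an MT-algebra. -/
def IsMT {M : Type*} [CompleteBooleanAlgebra M] (box : M → M) : Prop :=
  box ⊤ = ⊤ ∧ (∀ a b : M, box (a ⊓ b) = box a ⊓ box b) ∧
    (∀ a : M, box a ≤ a) ∧ (∀ a : M, box a ≤ box (box a))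

/-- A subset `S` of a complete lattice is join-dense if every element is a join
of a subset of `S`. -/
def JoinDense {M : Type*} [CompleteLattice M] (S : Set M) : Prop :=
  ∀ a : M, ∃ T ⊆ S, a = sSup T

/-- `k` is compact: every open cover of `k` has a finite subcover. -/
def MTCompactElem {M : Type*} [CompleteBooleanAlgebra M] (box : M → M) (k : M) : Prop :=
  ∀ U : Set M, (∀ u ∈ U, MTOpen box u) → k ≤ sSup U →
    ∃ V ⊆ U, V.Finite ∧ k ≤ sSup V

/-- `a ◁ b` iff there is a compact `k` with `a ≤ k ≤ b`. -/
def MTWayInside {M : Type*} [CompleteBooleanAlgebra M] (box : M → M) (a b : M) : Prop :=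
  ∃ k : M, MTCompactElem box k ∧ a ≤ k ∧ k ≤ b

/-- `M` is N-locally compact if every nonzero `a` meets the interior of some
compact element. -/
def MTNLocallyCompact {M : Type*} [CompleteBooleanAlgebra M] (box : M → M) : Prop :=
  ∀ a : M, a ≠ ⊥ → ∃ k : M, MTCompactElem box k ∧ a ⊓ box k ≠ ⊥

/-- `M` is locally compact if every open is the join of the opens way inside it. -/
def MTLocallyCompact {M : Type*} [CompleteBooleanAlgebra M] (box : M → M) : Prop :=
  ∀ u : M, MTOpen box u → u = sSup {v : M | MTOpen box v ∧ MTWayInside box v u}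

/-- `s` is saturated if it is a meet of a set of open elements. -/
def MTSaturated {M : Type*} [CompleteBooleanAlgebra M] (box : M → M) (s : M) : Prop :=
  ∃ U : Set M, (∀ u ∈ U, MTOpen box u) ∧ s = sInf U

/-- `a` is a `T₀`-element if it is the meet of a saturated and a closed element. -/
def MTT0Elem {M : Type*} [CompleteBooleanAlgebra M] (box : M → M) (a : M) : Prop :=
  ∃ s c : M, MTSaturated box s ∧ MTClosed box c ∧ a = s ⊓ c

theorem IsMT.monotone {M : Type*} [CompleteBooleanAlgebra M] {box : M → M}
    (hMT : IsMT box) : Monotone box := fun x y hxy => by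
  rw [← inf_eq_left, ← hMT.2.1, inf_eq_left.mpr hxy]

theorem MTOpen.sSup {M : Type*} [CompleteBooleanAlgebra M] {box : M → M}
    (hMT : IsMT box) {S : Set M} (hS : ∀ s ∈ S, MTOpen box s) : MTOpen box (sSup S) :=
  le_antisymm (hMT.2.2.1 _) <| sSup_le fun s hs =>
    (hS s hs).ge.trans (hMT.monotone (le_sSup hs))

/-- In any MT-algebra, joins of opens are exact for saturated elements:
for saturated `a` and a set `S` of opens, the join of `{a ⊓ s : s ∈ S}` computed in
the lattice of saturated elements equals `a ⊓ ⨆ S`. -/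
theorem open_joins_exact {M : Type*} [CompleteBooleanAlgebra M] (box : M → M)
    (hMT : IsMT box) (a : M) (ha : MTSaturated box a)
    (S : Set M) (hS : ∀ s ∈ S, MTOpen box s) :
    sInf {u : M | MTOpen box u ∧ ∀ s ∈ S, a ⊓ s ≤ u} = a ⊓ sSup S := by
  obtain ⟨U, hU, rfl⟩ := ha
  apply le_antisymm
  · refine le_inf (le_sInf fun u hu => sInf_le ⟨hU u hu, fun s _ => ?_⟩)
      (sInf_le ⟨MTOpen.sSup hMT hS, fun s hs => inf_le_right.trans (le_sSup hs)⟩)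
    exact inf_le_left.trans (sInf_le hu)
  · refine le_sInf fun u hu => ?_
    rw [inf_sSup_eq]
    exact iSup₂_le hu.2
end

section
/- Let M be a T₀-algebra. Then M is atomic (every nonzero element has an atom below it) if and only if every saturated element of M is the join, computed in the lattice of saturated elements, of the completely join-prime saturated elements below it; that is, for every saturated a, a = ⨅{t saturated : p ≤ t for every completely join-prime saturated p with p ≤ a}. -/
/-- A saturated element `p` is completely join-prime in the lattice of saturated
elements: `p ≠ ⊥` and `p` below a join (of saturated elements, computed among
saturated elements) implies `p` is below some member. -/
def MTCJP {M : Type*} [CompleteBooleanAlgebra M] (box : M → M) (p : M) : Prop :=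
  MTSaturated box p ∧ p ≠ ⊥ ∧
    ∀ T : Set M, (∀ s ∈ T, MTSaturated box s) →
      p ≤ sInf {t : M | MTSaturated box t ∧ ∀ s ∈ T, s ≤ t} → ∃ s ∈ T, p ≤ s

section SaturatedElements

variable {M : Type*} [CompleteBooleanAlgebra M] {box : M → M}

theorem MTOpen.saturated {u : M} (hu : MTOpen box u) : MTSaturated box u :=
  ⟨{u}, by simpa using hu, by simp⟩

theorem MTClosed.compl_open {c : M} (hc : MTClosed box c) : MTOpen box cᶜ := by
  have h : (box cᶜ)ᶜ = c := hc
  exact compl_injective (h.trans (compl_compl c).symm)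

theorem IsMT.box_mono (h : IsMT box) : Monotone box := fun a b hab => by
  have := h.2.1 a b
  rw [inf_eq_left.mpr hab] at this
  exact this ▸ inf_le_right

theorem IsMT.open_box (h : IsMT box) (a : M) : MTOpen box (box a) :=
  le_antisymm (h.2.2.1 _) (h.2.2.2 _)

theorem MTSaturated.exists_open_of_not_le {s b : M} (hs : MTSaturated box s) (h : ¬ b ≤ s) :
    ∃ u, MTOpen box u ∧ s ≤ u ∧ ¬ b ≤ u := by
  obtain ⟨U, hU, rfl⟩ := hs
  by_contra! hc
  exact h (le_sInf fun u hu => hc u (hU u hu) (sInf_le hu))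

/-- A saturated element missing an atom `x` lies below the open element `□¬x`. -/
theorem MTSaturated.le_box_compl (h : IsMT box) {s x : M} (hs : MTSaturated box s)
    (hx : IsAtom x) (hxs : ¬ x ≤ s) : s ≤ box xᶜ := by
  obtain ⟨u, hu, hsu, hxu⟩ := hs.exists_open_of_not_le hxs
  have hux : u ≤ xᶜ := le_compl_iff_disjoint_left.mpr (hx.not_le_iff_disjoint.mp hxu)
  exact hsu.trans (hu.symm.le.trans (h.box_mono hux))

/-- The saturation of an element: the meet of the open elements above it. -/
def MTsat (box : M → M) (x : M) : M :=
  sInf {u | MTOpen box u ∧ x ≤ u}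

theorem saturated_MTsat (x : M) : MTSaturated box (MTsat box x) :=
  ⟨_, fun _ hu => hu.1, rfl⟩

theorem le_MTsat (x : M) : x ≤ MTsat box x :=
  le_sInf fun _ hu => hu.2

theorem MTSaturated.MTsat_le {s x : M} (hs : MTSaturated box s) (h : x ≤ s) :
    MTsat box x ≤ s := by
  obtain ⟨U, hU, rfl⟩ := hs
  exact le_sInf fun u hu => sInf_le ⟨hU u hu, h.trans (sInf_le hu)⟩

theorem IsAtom.cjp_MTsat (h : IsMT box) {x : M} (hx : IsAtom x) : MTCJP box (MTsat box x) := by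
  refine ⟨saturated_MTsat x, ne_bot_of_le_ne_bot hx.1 (le_MTsat x), fun T hT hle => ?_⟩
  by_contra! hc
  have hxbox : x ≤ box xᶜ := (le_MTsat x).trans <| hle.trans <| sInf_le
    ⟨(h.open_box _).saturated, fun s hs =>
      (hT s hs).le_box_compl h hx fun hxs => hc s hs ((hT s hs).MTsat_le hxs)⟩
  exact hx.1 (le_compl_self.mp (hxbox.trans (h.2.2.1 _)))

/-- For a completely join-prime `p` there is a largest saturated element not above `p`,
and it is open. -/
theorem MTCJP.exists_open_greatest {p : M} (hp : MTCJP box p) :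
    ∃ u, MTOpen box u ∧ ¬ p ≤ u ∧ ∀ s, MTSaturated box s → ¬ p ≤ s → s ≤ u := by
  have hnot : ¬ p ≤ sInf {t : M | MTSaturated box t ∧
      ∀ s ∈ {s | MTSaturated box s ∧ ¬ p ≤ s}, s ≤ t} := fun hle => by
    obtain ⟨s, hs, hps⟩ := hp.2.2 _ (fun s hs => hs.1) hle
    exact hs.2 hps
  rw [le_sInf_iff] at hnot
  push Not at hnot
  obtain ⟨t, ⟨ht, hTt⟩, hpt⟩ := hnot
  obtain ⟨u, hu, htu, hpu⟩ := ht.exists_open_of_not_le hpt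
  exact ⟨u, hu, hpu, fun s hs hps => (hTt s ⟨hs, hps⟩).trans htu⟩

theorem JoinDense.exists_ne_bot_le {S : Set M} (hS : JoinDense S) {a : M} (ha : a ≠ ⊥) :
    ∃ b ∈ S, b ≠ ⊥ ∧ b ≤ a := by
  obtain ⟨T, hT, rfl⟩ := hS a
  by_contra! hc
  exact ha (sSup_eq_bot.mpr fun b hb => by_contra fun hne => hc b (hT hb) hne (le_sSup hb))

/-- In a `T₀`-algebra, a completely join-prime `p` meets the complement of the largest
saturated element not above `p` in an atom. -/
theorem isAtom_inf_compl (hT0 : JoinDense {a : M | MTT0Elem box a}) {p u : M}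
    (hpu : ¬ p ≤ u) (hmax : ∀ s, MTSaturated box s → ¬ p ≤ s → s ≤ u) :
    IsAtom (p ⊓ uᶜ) := by
  have hne : p ⊓ uᶜ ≠ ⊥ := fun h0 => hpu (by
    rwa [← disjoint_iff, disjoint_compl_right_iff] at h0)
  refine isAtom_iff_le_of_ge.mpr ⟨hne, fun y hy hyx => ?_⟩
  obtain ⟨b, ⟨s, c, hs, hc, rfl⟩, hb, hby⟩ := hT0.exists_ne_bot_le hy
  have hbx := hby.trans hyx
  have hps : p ≤ s := by
    by_contra hps
    exact hb (le_bot_iff.mp ((le_inf (inf_le_left.trans (hmax s hs hps))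
      (hbx.trans inf_le_right)).trans inf_compl_eq_bot.le))
  have hpc : ¬ p ≤ cᶜ := fun hpc =>
    hb (le_bot_iff.mp ((le_inf inf_le_right
      ((hbx.trans inf_le_left).trans hpc)).trans inf_compl_eq_bot.le))
  have huc : uᶜ ≤ c := compl_le_of_compl_le (hmax _ hc.compl_open.saturated hpc)
  exact (inf_le_inf hps huc).trans hby

end SaturatedElements

/-- A `T₀`-algebra is atomic iff every saturated element is the join (in the
lattice of saturated elements) of the completely join-prime saturated elements
below it. -/
theorem t0_atomic_iff_cjp_generate {M : Type*} [CompleteBooleanAlgebra M] (box : M → M)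
    (hMT : IsMT box) (hT0 : JoinDense {a : M | MTT0Elem box a}) :
    (∀ a : M, a ≠ ⊥ → ∃ x : M, IsAtom x ∧ x ≤ a) ↔
      ∀ a : M, MTSaturated box a →
        a = sInf {t : M | MTSaturated box t ∧
          ∀ p : M, MTCJP box p → p ≤ a → p ≤ t} := by
  constructor
  · intro hat a ha
    refine le_antisymm (le_sInf fun t ht => ?_) (sInf_le ⟨ha, fun p _ hpa => hpa⟩)
    by_contra hat'
    have hne : a ⊓ tᶜ ≠ ⊥ := fun h0 => hat' (by
      rwa [← disjoint_iff, disjoint_compl_right_iff] at h0)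
    obtain ⟨x, hx, hxa⟩ := hat _ hne
    have hxt : x ≤ t := (le_MTsat x).trans
      (ht.2 _ (hx.cjp_MTsat hMT) (ha.MTsat_le (hxa.trans inf_le_left)))
    exact hx.1 (le_bot_iff.mp ((le_inf hxt (hxa.trans inf_le_right)).trans inf_compl_eq_bot.le))
  · intro hgen a ha
    obtain ⟨b, ⟨s, c, hs, hc, rfl⟩, hb, hba⟩ := hT0.exists_ne_bot_le ha
    have hcsat := hc.compl_open.saturated
    obtain ⟨p, hp, hps, hpc⟩ : ∃ p, MTCJP box p ∧ p ≤ s ∧ ¬ p ≤ cᶜ := by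
      by_contra! hcon
      have hsc : s ≤ cᶜ := (hgen s hs).le.trans (sInf_le ⟨hcsat, hcon⟩)
      exact hb (disjoint_iff.mp (le_compl_iff_disjoint_right.mp hsc))
    obtain ⟨u, -, hpu, hmax⟩ := hp.exists_open_greatest
    exact ⟨p ⊓ uᶜ, isAtom_inf_compl hT0 hpu hmax,
      (inf_le_inf hps (compl_le_of_compl_le (hmax _ hcsat hpc))).trans hba⟩
end
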